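/- Let (X,d) be a finite ultrametric space with |X| ≥ 2. Then X ∈ ℜ if and only if there exists a point c ∈ X such that for every ultrametric ρ on X, if ρ(c,x) = d(c,x) for all x ∈ X, then ρ(x,y) = d(x,y) for all x,y ∈ X. -/

import Mathlib

/-- Membership in the class `ℜ`: every surjective self-isometry of `X` has at
least `|X| - 2` fixed points. -/
def maxRigid (X : Type*) [MetricSpace X] : Prop :=
  ∀ g : X → X, Function.Surjective g → (∀ x y : X, dist (g x) (g y) = dist x y) →
    Nat.card X - 2 ≤ {x : X | g x = x}.ncard

/-- A function `ρ : X → X → ℝ` is an ultrametric on `X` if it is symmetric,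
vanishes exactly on the diagonal, and satisfies the strong triangle
inequality. -/
def IsUltrametricOn {X : Type*} (ρ : X → X → ℝ) : Prop :=
  (∀ x y : X, ρ x y = ρ y x) ∧ (∀ x y : X, ρ x y = 0 ↔ x = y) ∧
    ∀ x y z : X, ρ x y ≤ max (ρ x z) (ρ z y)

theorem IsUltrametricOn.eq_max_of_ne {X : Type*} {ρ : X → X → ℝ} (hρ : IsUltrametricOn ρ)
    {c x y : X} (h : ρ c x ≠ ρ c y) : ρ x y = max (ρ c x) (ρ c y) := by
  obtain ⟨hs, -, ht⟩ := hρ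
  have h1 := ht x y c
  have h2 := ht c x y
  have h3 := ht c y x
  rw [hs x c] at h1
  rw [hs y x] at h2
  grind

theorem isUltrametricOn_dist (X : Type*) [MetricSpace X] [IsUltrametricDist X] :
    IsUltrametricOn (dist : X → X → ℝ) :=
  ⟨dist_comm, fun _ _ => dist_eq_zero, fun x y z => dist_triangle_max x z y⟩

/-- Halving all the distances between points equidistant from `c` yields an ultrametric. -/
theorem IsUltrametricOn.halve_spheres {X : Type*} {ρ : X → X → ℝ} (hρ : IsUltrametricOn ρ)
    (c : X) :
    IsUltrametricOn fun x y => if ρ c x = ρ c y then ρ x y / 2 else ρ x y := by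
  have key := fun x y => hρ.eq_max_of_ne (c := c) (x := x) (y := y)
  obtain ⟨hs, hz, ht⟩ := hρ
  have hn : ∀ x y, 0 ≤ ρ x y := fun x y => by
    have h1 := ht x x y
    have h2 := (hz x x).2 rfl
    rw [hs y x] at h1
    grind
  refine ⟨fun x y => ?_, fun x y => ?_, fun x y z => ?_⟩
  · have := hs x y
    grind
  · have := hz x y
    grind
  · have h1 := ht x y z
    have h2 := ht x y c
    rw [hs x c] at h2
    have h3 := key x y
    have h4 := key x z
    have h5 := key z y
    have h6 := hn x y
    have h7 := hn x z
    have h8 := hn z y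
    grind

/-- A finite ultrametric is determined by its restriction to the star centred at `c` exactly
when distinct points have distinct distances to `c`. -/
theorem forall_isUltrametricOn_eq_dist_iff {X : Type*} [MetricSpace X] [IsUltrametricDist X]
    (c : X) :
    (∀ ρ : X → X → ℝ, IsUltrametricOn ρ → (∀ x, ρ c x = dist c x) → ∀ x y, ρ x y = dist x y) ↔
      Function.Injective fun x => dist c x := by
  refine ⟨fun h x y hxy => ?_, fun h ρ hρ hc x y => ?_⟩
  · have h' := h _ ((isUltrametricOn_dist X).halve_spheres c) (fun x => ?_) x y
    · simp only at hxy
      rw [if_pos hxy] at h'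
      exact dist_eq_zero.1 (by linarith)
    · by_cases hx : dist c c = dist c x
      · rw [if_pos hx, ← hx, dist_self, zero_div]
      · rw [if_neg hx]
  · rcases eq_or_ne x y with rfl | hxy
    · rw [dist_self, (hρ.2.1 x x).2 rfl]
    · have hne : dist c x ≠ dist c y := fun e => hxy (h e)
      rw [(isUltrametricOn_dist X).eq_max_of_ne hne, hρ.eq_max_of_ne (c := c) (by rwa [hc, hc]),
        hc, hc]

theorem maxRigid_of_injective_dist {X : Type*} [MetricSpace X] [IsUltrametricDist X] [Finite X]
    {c : X} (hc : Function.Injective fun x => dist c x) : maxRigid X := by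
  intro g _ hg
  have hsub : {x | g x = x}ᶜ ⊆ {c, g c} := by
    intro x hx
    by_contra hcon
    simp only [Set.mem_insert_iff, Set.mem_singleton_iff, not_or] at hcon
    have hx' : g x ≠ x := hx
    have hgx : g x ≠ g c := fun e => hcon.1 (dist_eq_zero.1 (by rw [← hg, e, dist_self]))
    have h1 := (isUltrametricOn_dist X).eq_max_of_ne (c := c) (fun e => hgx (hc e))
    rw [hg, dist_comm x c] at h1
    rcases max_choice (dist c (g x)) (dist c (g c)) with h | h
    · exact hx' (hc (h1.trans h).symm)
    · exact hcon.2 (hc (h1.trans h))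
  have h1 := Set.ncard_le_ncard hsub (Set.toFinite _)
  have h2 : ({c, g c} : Set X).ncard ≤ 2 := by
    simpa using Set.ncard_insert_le c {g c}
  have h3 := Set.ncard_add_ncard_compl {x | g x = x}
  omega

/-- Swapping two points that are at the same distance from every other point is an isometry. -/
theorem dist_swap_swap {X : Type*} [MetricSpace X] [DecidableEq X] {a b : X}
    (h : ∀ z, z ≠ a → z ≠ b → dist a z = dist b z) (x y : X) :
    dist (Equiv.swap a b x) (Equiv.swap a b y) = dist x y := by
  have h1 := dist_comm x y
  have h2 := dist_comm x a
  have h3 := dist_comm x b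
  have h4 := h x
  have h5 := h y
  have h6 := dist_self a
  have h7 := dist_self b
  simp only [Equiv.swap_apply_def]
  grind

theorem not_maxRigid_of_swaps {X : Type*} [MetricSpace X] [Finite X] {a b x y : X}
    (hab : a ≠ b) (hxy : x ≠ y) (hax : a ≠ x) (hay : a ≠ y) (hby : b ≠ y)
    (h₁ : ∀ z, z ≠ a → z ≠ b → dist a z = dist b z)
    (h₂ : ∀ z, z ≠ x → z ≠ y → dist x z = dist y z) : ¬ maxRigid X := by
  classical
  intro h
  have hf := h (Equiv.swap a b * Equiv.swap x y) (Equiv.surjective _) fun u v => by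
    rw [Equiv.Perm.mul_apply, Equiv.Perm.mul_apply, dist_swap_swap h₁, dist_swap_swap h₂]
  have hsub : ({a, x, y} : Set X) ⊆ {z | (Equiv.swap a b * Equiv.swap x y) z = z}ᶜ := by
    intro z hz
    simp only [Set.mem_insert_iff, Set.mem_singleton_iff] at hz
    simp only [Set.mem_compl_iff, Set.mem_ofPred_eq, Equiv.Perm.mul_apply, Equiv.swap_apply_def]
    grind
  have h1 := Set.ncard_le_ncard hsub (Set.toFinite _)
  have h2 := Set.ncard_add_ncard_compl {z | (Equiv.swap a b * Equiv.swap x y) z = z}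
  have h3 : ({a, x, y} : Set X).ncard = 3 := Set.ncard_eq_three.2 ⟨a, x, y, hax, hay, hxy, rfl⟩
  omega

theorem exists_injective_dist_of_maxRigid {X : Type*} [MetricSpace X] [IsUltrametricDist X]
    [Finite X] [Nontrivial X] (h : maxRigid X) :
    ∃ c : X, Function.Injective fun x => dist c x := by
  obtain ⟨⟨a, b⟩, hab, hmin⟩ := Set.exists_min_image {p : X × X | p.1 ≠ p.2}
    (fun p => dist p.1 p.2) (Set.toFinite _)
    (let ⟨u, v, huv⟩ := exists_pair_ne X; ⟨(u, v), huv⟩)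
  simp only [Set.mem_ofPred_eq, Prod.forall] at hab hmin
  have h₁ : ∀ z, z ≠ a → z ≠ b → dist a z = dist b z := by
    intro z hza hzb
    have h1 := hmin a z hza.symm
    have h2 := hmin b z hzb.symm
    have h3 := dist_triangle_max a b z
    have h4 := dist_triangle_max b a z
    rw [dist_comm b a] at h4
    grind
  refine ⟨a, ?_⟩
  by_contra hinj
  obtain ⟨⟨x, y⟩, ⟨hxy, hd⟩, hmin'⟩ := Set.exists_min_image
    {p : X × X | p.1 ≠ p.2 ∧ dist a p.1 = dist a p.2}
    (fun p => dist p.1 p.2) (Set.toFinite _) (by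
      simp only [Function.Injective, not_forall] at hinj
      obtain ⟨u, v, huv, hne⟩ := hinj
      exact ⟨(u, v), hne, huv⟩)
  simp only [Set.mem_ofPred_eq, Prod.forall, and_imp] at hxy hd hmin'
  have hle : dist x y ≤ dist a x := by
    have := dist_triangle_max x a y
    rwa [dist_comm x a, ← hd, max_self] at this
  have far : ∀ w z, dist a w = dist a x → z ≠ w → dist x y ≤ dist w z := by
    intro w z hw hzw
    by_contra! hlt
    refine hlt.not_ge (hmin' w z hzw.symm ?_)
    by_contra hne
    have := (isUltrametricOn_dist X).eq_max_of_ne hne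
    have := le_max_left (dist a w) (dist a z)
    linarith
  have h₂ : ∀ z, z ≠ x → z ≠ y → dist x z = dist y z := by
    intro z hzx hzy
    have h1 := far x z rfl hzx
    have h2 := far y z hd.symm hzy
    have h3 := dist_triangle_max x y z
    have h4 := dist_triangle_max y x z
    rw [dist_comm y x] at h4
    grind
  have hax : a ≠ x := by
    rintro rfl
    rw [dist_self] at hd
    exact hxy (dist_eq_zero.1 hd.symm)
  have hay : a ≠ y := by
    rintro rfl
    rw [dist_self] at hd
    exact hax (dist_eq_zero.1 hd)
  by_cases hby : b = y
  · exact not_maxRigid_of_swaps hab hxy.symm hay hax (hby ▸ hxy.symm) h₁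
      (fun z hzy hzx => (h₂ z hzx hzy).symm) h
  · exact not_maxRigid_of_swaps hab hxy hax hay hby h₁ h₂ h

/-- A finite ultrametric space `X` with `|X| ≥ 2` belongs to
`ℜ` if and only if there is a point `c ∈ X` such that `d` is the unique
ultrametric on `X` agreeing with `d` on the spanning star centered at `c`:
every ultrametric `ρ` on `X` with `ρ(c, x) = d(c, x)` for all `x` coincides
with `d`. -/
theorem stmt17 (X : Type*) [MetricSpace X] [IsUltrametricDist X] [Fintype X]
    (hcard : 2 ≤ Fintype.card X) :
    maxRigid X ↔
      ∃ c : X, ∀ ρ : X → X → ℝ, IsUltrametricOn ρ →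
        (∀ x : X, ρ c x = dist c x) → ∀ x y : X, ρ x y = dist x y := by
  have : Nontrivial X := Fintype.one_lt_card_iff_nontrivial.1 hcard
  simp only [forall_isUltrametricOn_eq_dist_iff]
  exact ⟨exists_injective_dist_of_maxRigid, fun ⟨_, hc⟩ => maxRigid_of_injective_dist hc⟩
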